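/- Let a, b, c be positive real numbers, let {w_n} be the bi-periodic Horadam sequence with initial values w_0, w_1, and let {v_n} be the bi-periodic Lucas sequence. Then for all integers n, m, r, d > 0, w_{(m+2r)n+d} = v_m^{−n} · Σ_{i+j+s=n} (n!/(i!·j!·s!)) · (−1)^s · (−c)^{mj+(m+r)s} · v_r^j · w_{2(m+r)i+rj+d} · (a/b)^{ξ(r)·(j+ξ(j))/2 − ξ(m)·(n+ξ(n))/2 − ξ(rj)·ξ(d) + ξ(mn)·ξ(d)}, where the sum runs over all triples (i, j, s) of nonnegative integers with i + j + s = n, and (a/b) is raised to an integer power (possibly negative). -/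

import Mathlib

/-- The bi-periodic Horadam sequence with parameters `a, b, c` and
initial values `w0, w1`; the bi-periodic Lucas sequence is the
special case with initial values `2, b`. -/
def biper (a b c w0 w1 : ℝ) : ℕ → ℝ
  | 0 => w0
  | 1 => w1
  | n + 2 => (if Even (n + 2) then a else b) * biper a b c w0 w1 (n + 1)
      + c * biper a b c w0 w1 n

/-- The parity function ξ. -/
def xi (n : ℕ) : ℕ := n % 2

/-- The (possibly negative) integer exponent of `a/b` in equation (8) of the
paper: `ξ(r)·(j+ξ(j))/2 − ξ(m)·(n+ξ(n))/2 − ξ(rj)·ξ(d) + ξ(mn)·ξ(d)`. -/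
def expE (m n r d j : ℕ) : ℤ :=
  (xi r : ℤ) * ((j + xi j) / 2) - (xi m : ℤ) * ((n + xi n) / 2)
    - (xi (r * j) : ℤ) * (xi d) + (xi (m * n) : ℤ) * (xi d)

/-- The trinomial theorem as an iterated sum. -/
theorem sum_trinomial (x y z : ℝ) (n : ℕ) :
    ∑ i ∈ Finset.range (n + 1), ∑ j ∈ Finset.range (n + 1 - i),
      (n.factorial : ℝ) / ((i.factorial * j.factorial * (n - i - j).factorial : ℕ) : ℝ)
        * (x ^ i * y ^ j * z ^ (n - i - j)) = (x + y + z) ^ n := by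
  rw [add_assoc, add_pow]
  refine Finset.sum_congr rfl fun i hi => ?_
  have hi' : i ≤ n := Nat.lt_succ_iff.mp (Finset.mem_range.mp hi)
  rw [add_pow, Nat.sub_add_comm hi', Finset.mul_sum, Finset.sum_mul]
  refine Finset.sum_congr rfl fun j hj => ?_
  have hj' : j ≤ n - i := Nat.lt_succ_iff.mp (Finset.mem_range.mp hj)
  rw [Nat.cast_choose ℝ hi', Nat.cast_choose ℝ hj']
  have h (k : ℕ) : (k.factorial : ℝ) ≠ 0 := by exact_mod_cast k.factorial_ne_zero
  have h1 := h i
  have h2 := h j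
  have h3 := h (n - i)
  have h4 := h (n - i - j)
  push_cast
  field_simp

/-- Binet's formula for the bi-periodic Horadam sequence. -/
theorem biper_eq_binet {l u ρ w0 w1 A B : ℝ} (hρ : ρ ≠ 0) (h0 : A + B = w0)
    (h1 : A * l + B * u = w1 * ρ) (n : ℕ) :
    biper ((l + u) * ρ) ((l + u) / ρ) (-(l * u)) w0 w1 n * ρ ^ xi n
      = A * l ^ n + B * u ^ n := by
  induction n using Nat.twoStepInduction with
  | zero => simp [biper, xi, h0]
  | one => simp [biper, xi, h1]
  | more n ih ih' =>
    rw [biper]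
    rcases Nat.even_or_odd n with h | h
    · have e0 : xi n = 0 := Nat.even_iff.mp h
      have e1 : xi (n + 1) = 1 := Nat.odd_iff.mp h.add_one
      have h2 : Even (n + 2) := h.add even_two
      have e2 : xi (n + 2) = 0 := Nat.even_iff.mp h2
      rw [e0] at ih
      rw [e1] at ih'
      rw [e2, if_pos h2]
      linear_combination (l + u) * ih' - l * u * ih
    · have e0 : xi n = 1 := Nat.odd_iff.mp h
      have e1 : xi (n + 1) = 0 := Nat.even_iff.mp h.add_one
      have h2 : Odd (n + 2) := h.add_even even_two
      have e2 : xi (n + 2) = 1 := Nat.odd_iff.mp h2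
      rw [e0] at ih
      rw [e1] at ih'
      rw [e2, if_neg (Nat.not_even_iff_odd.mpr h2)]
      have hd : (l + u) / ρ * ρ = l + u := div_mul_cancel₀ _ hρ
      linear_combination (l + u) * ih' - l * u * ih
        + biper ((l + u) * ρ) ((l + u) / ρ) (-(l * u)) w0 w1 (n + 1) * hd

theorem biper_pos {a b c w0 w1 : ℝ} (ha : 0 < a) (hb : 0 < b) (hc : 0 < c) (h0 : 0 < w0)
    (h1 : 0 < w1) (n : ℕ) : 0 < biper a b c w0 w1 n := by
  induction n using Nat.twoStepInduction with
  | zero => exact h0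
  | one => exact h1
  | more n ih ih' =>
    rw [biper]
    split_ifs <;> positivity

theorem xi_add (m n : ℕ) : (xi (m + n) : ℤ) = xi m + xi n - 2 * (xi m * xi n) := by
  unfold xi
  rcases Nat.mod_two_eq_zero_or_one m with h | h <;>
    rcases Nat.mod_two_eq_zero_or_one n with h' | h' <;> simp [Nat.add_mod, h, h']

theorem xi_mul (m n : ℕ) : (xi (m * n) : ℤ) = xi m * xi n := by
  unfold xi
  rcases Nat.mod_two_eq_zero_or_one m with h | h <;>
    rcases Nat.mod_two_eq_zero_or_one n with h' | h' <;> simp [Nat.mul_mod, h, h']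

theorem xi_two_mul_add (m n : ℕ) : xi (2 * m + n) = xi n := by
  unfold xi
  omega

theorem two_mul_expE (m n r d j : ℕ) :
    2 * expE m n r d j = xi (r * j + d) + xi r * j - xi (m * n + d) - xi m * n := by
  have half (k : ℕ) : 2 * (((k : ℤ) + xi k) / 2) = k + xi k := by
    unfold xi
    omega
  rw [expE, xi_add, xi_add, xi_mul, xi_mul]
  linear_combination (xi r : ℤ) * half j - (xi m : ℤ) * half n

/-- The identity for a pure geometric sequence `l ^ k`, where `l` is a root of
`X ^ 2 = (l + u) * X - l * u`. -/
theorem sum_trinomial_root (l u : ℝ) (n m r d : ℕ) :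
    ∑ i ∈ Finset.range (n + 1), ∑ j ∈ Finset.range (n + 1 - i),
      (n.factorial : ℝ) / ((i.factorial * j.factorial * (n - i - j).factorial : ℕ) : ℝ)
        * (-1 : ℝ) ^ (n - i - j) * (l * u) ^ (m * j + (m + r) * (n - i - j))
        * (l ^ r + u ^ r) ^ j * l ^ (2 * (m + r) * i + r * j + d)
      = (l ^ m + u ^ m) ^ n * l ^ ((m + 2 * r) * n + d) := by
  have h := sum_trinomial (l ^ (2 * (m + r))) ((l * u) ^ m * (l ^ r + u ^ r) * l ^ r)
    (-(l * u) ^ (m + r)) n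
  have hs : l ^ (2 * (m + r)) + (l * u) ^ m * (l ^ r + u ^ r) * l ^ r + -(l * u) ^ (m + r)
      = (l ^ m + u ^ m) * l ^ (m + 2 * r) := by
    ring
  rw [hs, mul_pow (l ^ m + u ^ m), ← pow_mul l] at h
  rw [pow_add, ← mul_assoc, ← h, Finset.sum_mul]
  refine Finset.sum_congr rfl fun i _ => ?_
  rw [Finset.sum_mul]
  refine Finset.sum_congr rfl fun j _ => ?_
  rw [neg_pow ((l * u) ^ (m + r)), mul_pow ((l * u) ^ m * (l ^ r + u ^ r)),
    mul_pow ((l * u) ^ m), pow_add (l * u), pow_add l, pow_add l]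
  simp only [pow_mul]
  ring

theorem stmt15 (a b c w0 w1 : ℝ) (ha : 0 < a) (hb : 0 < b) (hc : 0 < c)
    (n m r d : ℕ) (hn : 0 < n) (hm : 0 < m) (hr : 0 < r) (hd : 0 < d) :
    biper a b c w0 w1 ((m + 2 * r) * n + d) =
      (biper a b c 2 b m) ^ (-(n : ℤ)) *
        ∑ i ∈ Finset.range (n + 1), ∑ j ∈ Finset.range (n + 1 - i),
          (n.factorial : ℝ)
              / ((i.factorial * j.factorial * (n - i - j).factorial : ℕ) : ℝ)
            * (-1 : ℝ) ^ (n - i - j)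
            * (-c) ^ (m * j + (m + r) * (n - i - j))
            * (biper a b c 2 b r) ^ j
            * biper a b c w0 w1 (2 * (m + r) * i + r * j + d)
            * (a / b) ^ (expE m n r d j) := by
  have hab : 0 < a * b := mul_pos ha hb
  set t := √(a * b) with ht
  set D := √(a * b + 4 * c) with hD
  set ρ := √(a / b) with hρdef
  have ht2 : t ^ 2 = a * b := Real.sq_sqrt hab.le
  have hD2 : D ^ 2 = a * b + 4 * c := Real.sq_sqrt (by positivity)
  have hDpos : 0 < D := Real.sqrt_pos.mpr (by positivity)
  have hρ2 : ρ ^ 2 = a / b := Real.sq_sqrt (by positivity)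
  have hρpos : 0 < ρ := Real.sqrt_pos.mpr (by positivity)
  have htρ : t * ρ = a := by
    rw [ht, hρdef, ← Real.sqrt_mul hab.le,
      show a * b * (a / b) = a ^ 2 by field_simp, Real.sqrt_sq ha.le]
  have htρ' : t / ρ = b := by
    rw [div_eq_iff hρpos.ne']
    have : t * (b * ρ - t) = 0 := by linear_combination b * htρ - ht2
    have ht0 : t ≠ 0 := (Real.sqrt_pos.mpr hab).ne'
    have := (mul_eq_zero.mp this).resolve_left ht0
    linarith
  obtain ⟨l, u, hlt, hlc, hlu⟩ : ∃ l u : ℝ, l + u = t ∧ -(l * u) = c ∧ l - u = D :=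
    ⟨(t + D) / 2, (t - D) / 2, by ring, by linear_combination (hD2 - ht2) / 4, by ring⟩
  obtain ⟨A, B, hA, hB⟩ : ∃ A B : ℝ, A + B = w0 ∧ A * l + B * u = w1 * ρ := by
    have hne : l - u ≠ 0 := by rw [hlu]; exact hDpos.ne'
    refine ⟨(w1 * ρ - w0 * u) / (l - u), (w0 * l - w1 * ρ) / (l - u), ?_, ?_⟩ <;>
      field_simp <;> ring
  have hw := biper_eq_binet hρpos.ne' hA hB
  have hv := biper_eq_binet (l := l) (u := u) (A := 1) (B := 1) (w0 := 2) (w1 := b)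
    hρpos.ne' (by norm_num) (by
      rw [one_mul, one_mul, hlt, ← htρ', div_mul_cancel₀ _ hρpos.ne'])
  rw [hlt, hlc, htρ, htρ'] at hw hv
  simp only [one_mul] at hv
  have eq_zpow {x y : ℝ} {k : ℕ} (h : x * ρ ^ k = y) : x = y * ρ ^ (-(k : ℤ)) := by
    rw [← h, zpow_neg, zpow_natCast, mul_assoc, mul_inv_cancel₀ (pow_ne_zero _ hρpos.ne'),
      mul_one]
  have hw' (k : ℕ) := eq_zpow (hw k)
  have hv' (k j : ℕ) : biper a b c 2 b k ^ j = (l ^ k + u ^ k) ^ j * ρ ^ (-(xi k * j : ℤ)) := by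
    rw [eq_zpow (hv k), mul_pow, ← zpow_natCast (ρ ^ _), ← zpow_mul, neg_mul]
  have hE (j : ℕ) : (a / b) ^ expE m n r d j
      = ρ ^ ((xi (r * j + d) : ℤ) + xi r * j - xi (m * n + d) - xi m * n) := by
    rw [← two_mul_expE, ← hρ2, zpow_mul, ← zpow_natCast, Nat.cast_ofNat]
  have hterm (i j : ℕ) : biper a b c 2 b r ^ j
      * biper a b c w0 w1 (2 * (m + r) * i + r * j + d) * (a / b) ^ expE m n r d j
      = (l ^ r + u ^ r) ^ j * (A * l ^ (2 * (m + r) * i + r * j + d)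
        + B * u ^ (2 * (m + r) * i + r * j + d)) * ρ ^ (-(xi (m * n + d) : ℤ) - xi m * n) := by
    have hk : xi (2 * (m + r) * i + r * j + d) = xi (r * j + d) := by
      rw [mul_assoc, add_assoc, xi_two_mul_add]
    rw [hv', hw', hE, hk, show (-(xi (m * n + d) : ℤ) - xi m * n)
      = -(xi r * j : ℤ) + -(xi (r * j + d) : ℤ)
        + ((xi (r * j + d) : ℤ) + xi r * j - xi (m * n + d) - xi m * n) by ring,
      zpow_add₀ hρpos.ne', zpow_add₀ hρpos.ne']
    ring
  have hL : xi ((m + 2 * r) * n + d) = xi (m * n + d) := by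
    rw [show (m + 2 * r) * n + d = 2 * (r * n) + (m * n + d) by ring, xi_two_mul_add]
  have hvpos : 0 < biper a b c 2 b m := biper_pos ha hb hc two_pos hb m
  rw [zpow_neg, zpow_natCast, eq_inv_mul_iff_mul_eq₀ (pow_ne_zero _ hvpos.ne'), hv', hw', hL]
  have hl := sum_trinomial_root l u n m r d
  have hu := sum_trinomial_root u l n m r d
  have hlc' : -c = l * u := by rw [← hlc, neg_neg]
  have hfactor : (l ^ m + u ^ m) ^ n * ρ ^ (-(xi m * n : ℤ))
      * ((A * l ^ ((m + 2 * r) * n + d) + B * u ^ ((m + 2 * r) * n + d))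
        * ρ ^ (-(xi (m * n + d) : ℤ)))
      = (A * ((l ^ m + u ^ m) ^ n * l ^ ((m + 2 * r) * n + d))
        + B * ((u ^ m + l ^ m) ^ n * u ^ ((m + 2 * r) * n + d)))
        * ρ ^ (-(xi (m * n + d) : ℤ) - xi m * n) := by
    rw [sub_eq_add_neg, zpow_add₀ hρpos.ne', add_comm (u ^ m)]
    ring
  rw [hfactor, ← hl, ← hu, Finset.mul_sum, Finset.mul_sum, ← Finset.sum_add_distrib,
    Finset.sum_mul]
  refine Finset.sum_congr rfl fun i _ => ?_
  rw [Finset.mul_sum, Finset.mul_sum, ← Finset.sum_add_distrib, Finset.sum_mul]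
  refine Finset.sum_congr rfl fun j _ => ?_
  rw [mul_assoc _ (_ ^ j) (biper _ _ _ _ _ _), mul_assoc _ (_ * _) ((a / b) ^ _), hterm, hlc',
    mul_comm u l, add_comm (u ^ r)]
  ring
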